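/- arXiv:2102.03867 — 2 statements merged into one kernel-verified Lean document; each statement's English description precedes it below -/
import Mathlib

section
/- The positional marked patterns 1\underline{2}34 and 1\underline{2}43 are pmp-Wilf equivalent: for all n, the statistic counting positions j such that j is the position of the '2' in an occurrence of 1234 in σ and the statistic counting positions j such that j is the position of the '2' in an occurrence of 1243 in σ are equidistributed over S_n. -/
/-- Number of positions `j` that play the role of the '2' in an occurrence of 1234
(pmp of `1\underline{2}34`). -/
noncomputable def pmp1234 {n : ℕ} (σ : Equiv.Perm (Fin n)) : ℕ :=
  Nat.card {j : Fin n //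
    ∃ i k l : Fin n, i < j ∧ j < k ∧ k < l ∧ σ i < σ j ∧ σ j < σ k ∧ σ k < σ l}

/-- Number of positions `j` that play the role of the '2' in an occurrence of 1243
(pmp of `1\underline{2}43`). -/
noncomputable def pmp1243 {n : ℕ} (σ : Equiv.Perm (Fin n)) : ℕ :=
  Nat.card {j : Fin n //
    ∃ i k l : Fin n, i < j ∧ j < k ∧ k < l ∧ σ i < σ j ∧ σ j < σ l ∧ σ l < σ k}

open Finset Classical in
/-- generalized statistic with threshold `p` -/
noncomputable def gstat (R : ℕ → ℕ → Prop) {n : ℕ} (p : ℕ) (σ : Equiv.Perm (Fin n)) : ℕ :=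
  ∑ j : Fin n, if ((p ≤ (j : ℕ) ∨ ∃ i, i < j ∧ σ i < σ j) ∧
    ∃ k l : Fin n, j < k ∧ k < l ∧ σ j < σ k ∧ σ j < σ l ∧ R (σ k) (σ l)) then 1 else 0

/-- the last `i` entries avoid `R` -/
def sufAv (R : ℕ → ℕ → Prop) {n : ℕ} (σ : Equiv.Perm (Fin n)) (i : ℕ) : Prop :=
  ∀ k l : Fin n, k < l → n ≤ (k : ℕ) + i → ¬ R (σ k) (σ l)

open Classical in
/-- length of the longest `R`-avoiding suffix -/
noncomputable def suf (R : ℕ → ℕ → Prop) {n : ℕ} (σ : Equiv.Perm (Fin n)) : ℕ :=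
  Nat.findGreatest (sufAv R σ) n

lemma sufAv_mono {R : ℕ → ℕ → Prop} {n : ℕ} {σ : Equiv.Perm (Fin n)} {i i' : ℕ}
    (h : i ≤ i') (H : sufAv R σ i') : sufAv R σ i :=
  fun k l hkl hk => H k l hkl (by omega)

lemma suf_le (R : ℕ → ℕ → Prop) {n : ℕ} (σ : Equiv.Perm (Fin n)) : suf R σ ≤ n :=
  by classical exact Nat.findGreatest_le _

lemma le_suf_iff (R : ℕ → ℕ → Prop) {n : ℕ} (σ : Equiv.Perm (Fin n)) (i : ℕ) (hi : i ≤ n) :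
    i ≤ suf R σ ↔ sufAv R σ i := by
  classical
  constructor
  · intro h
    have h0 : sufAv R σ 0 := fun k l _ hk => by omega
    have := Nat.findGreatest_spec (P := sufAv R σ) (Nat.zero_le n) h0
    refine sufAv_mono h ?_
    unfold suf
    convert this
  · intro h
    unfold suf
    convert Nat.le_findGreatest hi h

/-- insert a new minimum at position `q` -/
def insMin {n : ℕ} (q : Fin (n + 1)) (σ : Equiv.Perm (Fin n)) : Equiv.Perm (Fin (n + 1)) :=
  ((finSuccEquiv' q).trans (Equiv.optionCongr σ)).trans (finSuccEquiv' 0).symm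

lemma insMin_self {n : ℕ} (q : Fin (n + 1)) (σ : Equiv.Perm (Fin n)) : insMin q σ q = 0 := by
  simp [insMin]

lemma insMin_succAbove {n : ℕ} (q : Fin (n + 1)) (σ : Equiv.Perm (Fin n)) (x : Fin n) :
    insMin q σ (q.succAbove x) = (σ x).succ := by
  simp [insMin]

lemma insMin_bij (n : ℕ) : Function.Bijective
    (fun x : Fin (n + 1) × Equiv.Perm (Fin n) => insMin x.1 x.2) := by
  rw [Fintype.bijective_iff_injective_and_card]
  constructor
  · rintro ⟨q, σ⟩ ⟨q', σ'⟩ h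
    simp only at h
    have hq : q = q' := by
      apply (insMin q' σ').injective
      rw [insMin_self, ← h, insMin_self]
    subst hq
    have : σ = σ' := by
      ext x
      have := congrArg (fun e => e (q.succAbove x)) h
      simp only [insMin_succAbove] at this
      exact congrArg Fin.val (Fin.succ_injective _ this)
    rw [this]
  · simp [Fintype.card_perm, Nat.factorial_succ]

lemma sum_perm_succ {n : ℕ} (F : Equiv.Perm (Fin (n + 1)) → ℕ) :
    ∑ σ, F σ = ∑ q : Fin (n + 1), ∑ σ : Equiv.Perm (Fin n), F (insMin q σ) := by
  rw [← (insMin_bij n).sum_comp, Fintype.sum_prod_type]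

lemma succAbove_val {n : ℕ} (q : Fin (n + 1)) (x : Fin n) :
    ((q.succAbove x : Fin (n + 1)) : ℕ) = if (x : ℕ) < q then (x : ℕ) else x + 1 := by
  unfold Fin.succAbove
  simp only [Fin.lt_def, Fin.val_castSucc]
  split_ifs <;> simp

lemma sufAv_insMin_le {R : ℕ → ℕ → Prop} (hR : ∀ a b, R (a + 1) (b + 1) ↔ R a b) {n : ℕ}
    (q : Fin (n + 1)) (σ : Equiv.Perm (Fin n)) (k : ℕ) (hk : k + q ≤ n) :
    sufAv R (insMin q σ) k ↔ sufAv R σ k := by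
  constructor
  · intro H a b hab ha
    have := H (q.succAbove a) (q.succAbove b) (by simpa using hab)
      (by rw [succAbove_val]; split_ifs <;> omega)
    simpa [insMin_succAbove, hR] using this
  · intro H a b hab ha
    rcases Fin.eq_self_or_eq_succAbove q a with rfl | ⟨a, rfl⟩
    · omega
    rcases Fin.eq_self_or_eq_succAbove q b with rfl | ⟨b, rfl⟩
    · rw [Fin.lt_def] at hab; omega
    simp only [insMin_succAbove, Fin.val_succ, hR]
    apply H a b (by simpa using hab)
    rw [succAbove_val] at ha; split_ifs at ha <;> omega

lemma sufAv_insMin_gt {R : ℕ → ℕ → Prop} (hR : ∀ a b, R (a + 1) (b + 1) ↔ R a b) {n : ℕ}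
    (q : Fin (n + 1)) (σ : Equiv.Perm (Fin n)) (k : ℕ) (hk : n < k + q) :
    sufAv R (insMin q σ) k ↔ (sufAv R σ (k - 1) ∧
      (∀ a : Fin n, q ≤ (a : ℕ) → ¬ R 0 (σ a + 1)) ∧
      (∀ a : Fin n, (a : ℕ) < q → n + 1 ≤ a + k → ¬ R (σ a + 1) 0)) := by
  constructor
  · intro H
    refine ⟨?_, ?_, ?_⟩
    · intro a b hab ha
      have := H (q.succAbove a) (q.succAbove b) (by simpa using hab)
        (by rw [succAbove_val]; split_ifs <;> omega)
      simpa [insMin_succAbove, hR] using this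
    · intro a ha
      have := H q (q.succAbove a)
        (by rw [Fin.lt_def, succAbove_val]; split_ifs <;> omega) (by omega)
      simpa [insMin_succAbove, insMin_self] using this
    · intro a ha hak
      have := H (q.succAbove a) q
        (by rw [Fin.lt_def, succAbove_val]; split_ifs; omega)
        (by rw [succAbove_val]; split_ifs; omega)
      simpa [insMin_succAbove, insMin_self] using this
  · rintro ⟨H1, H2, H3⟩ a b hab ha
    rcases Fin.eq_self_or_eq_succAbove q a with rfl | ⟨a, rfl⟩
    · rcases Fin.eq_self_or_eq_succAbove a b with rfl | ⟨b, rfl⟩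
      · simp at hab
      rw [Fin.lt_def, succAbove_val] at hab
      simpa [insMin_succAbove, insMin_self] using H2 b (by split_ifs at hab <;> omega)
    rcases Fin.eq_self_or_eq_succAbove q b with rfl | ⟨b, rfl⟩
    · rw [Fin.lt_def, succAbove_val] at hab
      rw [succAbove_val] at ha
      have h1 : (a : ℕ) < b := by split_ifs at hab <;> omega
      rw [if_pos h1] at ha
      simpa [insMin_succAbove, insMin_self] using H3 a h1 ha
    · simp only [insMin_succAbove, Fin.val_succ, hR]
      apply H1 a b (by simpa using hab)
      rw [succAbove_val] at ha; split_ifs at ha <;> omega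

lemma eq_of_le_iff {a b N : ℕ} (ha : a ≤ N) (hb : b ≤ N) (h : ∀ k ≤ N, (k ≤ a ↔ k ≤ b)) :
    a = b :=
  le_antisymm ((h a ha).1 le_rfl) ((h b hb).2 le_rfl)

lemma suf_insMin_lt {n : ℕ} (q : Fin (n + 1)) (σ : Equiv.Perm (Fin n)) :
    suf (· < ·) (insMin q σ) =
      if n - (q : ℕ) = 0 then suf (· < ·) σ + 1 else min (suf (· < ·) σ) (n - q) := by
  have hs := suf_le (· < ·) σ
  apply eq_of_le_iff (suf_le _ _) (by split_ifs <;> omega)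
  intro k hk
  rw [le_suf_iff _ _ _ hk]
  rcases Nat.lt_or_ge n (k + q) with h | h
  · rw [sufAv_insMin_gt (by simp) _ _ _ h, ← le_suf_iff _ _ _ (by omega)]
    by_cases hq : n - (q : ℕ) = 0
    · rw [if_pos hq]
      constructor
      · rintro ⟨h1, -⟩; omega
      · intro h1
        exact ⟨by omega, fun a ha => by omega, by simp⟩
    · rw [if_neg hq]
      constructor
      · rintro ⟨-, h1, -⟩
        exact absurd (h1 ⟨q, by omega⟩ le_rfl) (by simp)
      · intro h1; omega
  · rw [sufAv_insMin_le (by simp) _ _ _ h, ← le_suf_iff _ _ _ (by omega)]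
    split_ifs <;> omega

lemma suf_insMin_gt {n : ℕ} (q : Fin (n + 1)) (σ : Equiv.Perm (Fin n)) :
    suf (· > ·) (insMin q σ) =
      if n - (q : ℕ) ≤ suf (· > ·) σ then n - (q : ℕ) + 1 else suf (· > ·) σ := by
  have hs := suf_le (· > ·) σ
  apply eq_of_le_iff (suf_le _ _) (by split_ifs <;> omega)
  intro k hk
  rw [le_suf_iff _ _ _ hk]
  rcases Nat.lt_or_ge n (k + q) with h | h
  · rw [sufAv_insMin_gt (by simp) _ _ _ h, ← le_suf_iff _ _ _ (by omega)]
    constructor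
    · rintro ⟨h1, -, h2⟩
      have : k ≤ n - q + 1 := by
        by_contra hc
        exact h2 ⟨q - 1, by omega⟩ (by simp only; omega) (by simp only; omega) (by simp)
      split_ifs <;> omega
    · intro h1
      split_ifs at h1
      · exact ⟨by omega, by simp, fun a ha hak => by omega⟩
      · omega
  · rw [sufAv_insMin_le (by simp) _ _ _ h, ← le_suf_iff _ _ _ (by omega)]
    split_ifs <;> omega

lemma gstat_insMin {R : ℕ → ℕ → Prop} (hR : ∀ a b, R (a + 1) (b + 1) ↔ R a b) {n : ℕ}
    (p : ℕ) (q : Fin (n + 1)) (σ : Equiv.Perm (Fin n)) :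
    gstat R p (insMin q σ) = gstat R (min p q) σ +
      if p ≤ (q : ℕ) ∧ suf R σ < n - q then 1 else 0 := by
  classical
  unfold gstat
  rw [Fin.sum_univ_succAbove _ q, add_comm]
  congr 1
  · apply Finset.sum_congr rfl
    intro j _
    congr 1
    apply propext
    apply and_congr
    · constructor
      · rintro (h | ⟨i, hi, hi'⟩)
        · left
          rw [succAbove_val] at h; split_ifs at h <;> omega
        · rcases Fin.eq_self_or_eq_succAbove q i with rfl | ⟨i, rfl⟩
          · left
            rw [Fin.lt_def, succAbove_val] at hi; split_ifs at hi <;> omega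
          · right
            exact ⟨i, by simpa using hi, by simpa [insMin_succAbove] using hi'⟩
      · rintro (h | ⟨i, hi, hi'⟩)
        · by_cases hj : (j : ℕ) < q
          · left
            rw [succAbove_val, if_pos hj]; omega
          · right
            refine ⟨q, ?_, ?_⟩
            · rw [Fin.lt_def, succAbove_val, if_neg hj]; omega
            · simp [insMin_succAbove, insMin_self]
        · right
          exact ⟨q.succAbove i, by simpa using hi, by simpa [insMin_succAbove] using hi'⟩
    · constructor
      · rintro ⟨k, l, h1, h2, h3, h4, h5⟩
        rcases Fin.eq_self_or_eq_succAbove q k with rfl | ⟨k, rfl⟩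
        · simp [insMin_self] at h3
        rcases Fin.eq_self_or_eq_succAbove q l with rfl | ⟨l, rfl⟩
        · simp [insMin_self] at h4
        simp only [insMin_succAbove, Fin.val_succ, hR, Fin.succAbove_lt_succAbove_iff,
          Fin.succ_lt_succ_iff] at h1 h2 h3 h4 h5
        exact ⟨k, l, h1, h2, h3, h4, h5⟩
      · rintro ⟨k, l, h1, h2, h3, h4, h5⟩
        refine ⟨q.succAbove k, q.succAbove l, ?_⟩
        simp only [insMin_succAbove, Fin.val_succ, hR, Fin.succAbove_lt_succAbove_iff,
          Fin.succ_lt_succ_iff]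
        exact ⟨h1, h2, h3, h4, h5⟩
  · congr 1
    apply propext
    rw [← not_le, le_suf_iff _ _ _ (by omega)]
    apply and_congr
    · constructor
      · rintro (h | ⟨i, hi, hi'⟩)
        · exact h
        · simp [insMin_self] at hi'
      · exact Or.inl
    · unfold sufAv
      push Not
      constructor
      · rintro ⟨k, l, h1, h2, h3, h4, h5⟩
        rcases Fin.eq_self_or_eq_succAbove q k with rfl | ⟨k, rfl⟩
        · simp at h1
        rcases Fin.eq_self_or_eq_succAbove q l with rfl | ⟨l, rfl⟩
        · simp at h4
        simp only [insMin_succAbove, Fin.val_succ, hR, Fin.succAbove_lt_succAbove_iff] at h2 h5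
        refine ⟨k, l, h2, ?_, h5⟩
        rw [Fin.lt_def, succAbove_val] at h1
        split_ifs at h1 <;> omega
      · rintro ⟨k, l, h1, h2, h3⟩
        refine ⟨q.succAbove k, q.succAbove l, ?_, by simpa using h1, ?_, ?_, ?_⟩
        · rw [Fin.lt_def, succAbove_val]; split_ifs <;> omega
        · simp [insMin_succAbove, insMin_self]
        · simp [insMin_succAbove, insMin_self]
        · simpa [insMin_succAbove, hR] using h3

/-- the two insertion rules produce the same multiset of labels -/
lemma label_sum (f : ℕ → ℕ → ℕ) (a t N : ℕ) (ht : t ≤ N) :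
    ∑ i ∈ Finset.range (N + 1),
        f (a + if t < i then 1 else 0) (if i = 0 then t + 1 else min t i) =
      ∑ i ∈ Finset.range (N + 1),
        f (a + if t < i then 1 else 0) (if i ≤ t then i + 1 else t) := by
  obtain ⟨d, rfl⟩ := Nat.exists_eq_add_of_le ht
  rw [show t + d + 1 = (t + 1) + d by omega, Finset.sum_range_add _ (t + 1) d,
    Finset.sum_range_add _ (t + 1) d]
  congr 1
  · rw [Finset.sum_range_succ', Finset.sum_range_succ]
    congr 1
    · apply Finset.sum_congr rfl
      intro i hi
      rw [Finset.mem_range] at hi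
      rw [if_neg (by omega), if_neg (by omega), if_neg (by omega), if_pos (by omega),
        min_eq_right (by omega)]
    · simp
  · apply Finset.sum_congr rfl
    intro i hi
    rw [if_pos (by omega), if_neg (by omega), if_neg (by omega), min_eq_left (by omega)]

lemma sum_filter_reflect (n p : ℕ) (hp : p ≤ n) (h : ℕ → ℕ) :
    ∑ q : Fin (n + 1), (if p ≤ (q : ℕ) then h (n - q) else 0) =
      ∑ i ∈ Finset.range (n - p + 1), h i := by
  rw [Fin.sum_univ_eq_sum_range (fun q => if p ≤ q then h (n - q) else 0), ← Finset.sum_filter]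
  apply Finset.sum_bij' (fun q _ => n - q) (fun i _ => n - i)
  · intro q hq; simp only [Finset.mem_filter, Finset.mem_range] at hq ⊢; omega
  · intro q hq; simp only [Finset.mem_filter, Finset.mem_range] at hq ⊢; omega
  · intro q hq; simp only [Finset.mem_filter, Finset.mem_range] at hq ⊢; omega
  · intro q hq; simp only [Finset.mem_range] at hq ⊢; omega
  · intro q hq; rfl

lemma main_sum (n : ℕ) : ∀ (p : ℕ), p ≤ n → ∀ f : ℕ → ℕ → ℕ,
    ∑ σ : Equiv.Perm (Fin n), f (gstat (· < ·) p σ) (min (suf (· < ·) σ) (n - p)) =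
      ∑ σ : Equiv.Perm (Fin n), f (gstat (· > ·) p σ) (min (suf (· > ·) σ) (n - p)) := by
  induction n with
  | zero =>
    intro p hp f
    simp [gstat, suf]
  | succ n ih =>
    intro p hp f
    rw [sum_perm_succ, sum_perm_succ]
    have split : ∀ F : Fin (n + 1) → ℕ, ∑ q, F q =
        ∑ q : Fin (n + 1), (if p ≤ (q : ℕ) then 0 else F q) +
        ∑ q : Fin (n + 1), (if p ≤ (q : ℕ) then F q else 0) := by
      intro F
      rw [← Finset.sum_add_distrib]
      apply Finset.sum_congr rfl
      intro q _
      split_ifs <;> simp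
    rw [split, split (fun q => ∑ σ : Equiv.Perm (Fin n), f (gstat (· > ·) p (insMin q σ)) _)]
    congr 1
    · apply Finset.sum_congr rfl
      intro q _
      split_ifs with hq
      · rfl
      have key := ih q (by omega) (fun a t => f a (min t (n + 1 - p)))
      convert key using 2 with σ _ σ _
      · rw [gstat_insMin (by simp), suf_insMin_lt, if_neg (by tauto), min_eq_right (by omega)]
        congr 1
        split_ifs <;> omega
      · rw [gstat_insMin (by simp), suf_insMin_gt, if_neg (by tauto), min_eq_right (by omega)]
        congr 1
        split_ifs <;> omega
    · by_cases hpn : p ≤ n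
      · have key := ih p hpn (fun a t => ∑ i ∈ Finset.range (n - p + 1),
          f (a + if t < i then 1 else 0) (if i ≤ t then i + 1 else t))
        have pull : ∀ G : Fin (n + 1) → Equiv.Perm (Fin n) → ℕ,
            ∑ q : Fin (n + 1), (if p ≤ (q : ℕ) then ∑ σ, G q σ else 0) =
              ∑ σ, ∑ q : Fin (n + 1), (if p ≤ (q : ℕ) then G q σ else 0) := by
          intro G
          rw [Finset.sum_comm]
          apply Finset.sum_congr rfl
          intro q _
          split_ifs <;> simp
        rw [pull, pull]
        convert key using 2 with σ _ σ _
        · rw [← label_sum _ _ _ _ (min_le_right _ _), ← sum_filter_reflect n p hpn]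
          apply Finset.sum_congr rfl
          intro q _
          split_ifs with hq <;> try rfl
          all_goals
            rw [gstat_insMin (by simp), suf_insMin_lt, min_eq_left hq]
            congr 1
            · congr 1
              split_ifs <;> omega
            · split_ifs <;> omega
        · rw [← sum_filter_reflect n p hpn]
          apply Finset.sum_congr rfl
          intro q _
          by_cases hq : p ≤ (q : ℕ)
          · rw [if_pos hq, if_pos hq]
            rw [gstat_insMin (by simp), suf_insMin_gt, min_eq_left hq]
            congr 1
            · congr 1
              split_ifs <;> omega
            · split_ifs <;> omega
          · rw [if_neg hq, if_neg hq]
      · apply Finset.sum_congr rfl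
        intro q _
        rw [if_neg (by omega), if_neg (by omega)]

lemma pmp1234_eq {n : ℕ} (σ : Equiv.Perm (Fin n)) : pmp1234 σ = gstat (· < ·) n σ := by
  classical
  unfold pmp1234 gstat
  rw [Nat.card_eq_fintype_card, Fintype.card_subtype, Finset.card_filter]
  apply Finset.sum_congr rfl
  intro j _
  congr 1
  apply propext
  constructor
  · rintro ⟨i, k, l, h1, h2, h3, h4, h5, h6⟩
    exact ⟨Or.inr ⟨i, h1, h4⟩, k, l, h2, h3, h5, h5.trans h6, h6⟩
  · rintro ⟨h | ⟨i, h1, h4⟩, k, l, h2, h3, h5, -, h6⟩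
    · omega
    · exact ⟨i, k, l, h1, h2, h3, h4, h5, h6⟩

lemma pmp1243_eq {n : ℕ} (σ : Equiv.Perm (Fin n)) : pmp1243 σ = gstat (· > ·) n σ := by
  classical
  unfold pmp1243 gstat
  rw [Nat.card_eq_fintype_card, Fintype.card_subtype, Finset.card_filter]
  apply Finset.sum_congr rfl
  intro j _
  congr 1
  apply propext
  constructor
  · rintro ⟨i, k, l, h1, h2, h3, h4, h5, h6⟩
    exact ⟨Or.inr ⟨i, h1, h4⟩, k, l, h2, h3, h5.trans h6, h5, h6⟩
  · rintro ⟨h | ⟨i, h1, h4⟩, k, l, h2, h3, -, h5, h6⟩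
    · omega
    · exact ⟨i, k, l, h1, h2, h3, h4, h5, h6⟩

theorem stmt12 (n m : ℕ) :
    Nat.card {σ : Equiv.Perm (Fin n) // pmp1234 σ = m} =
      Nat.card {σ : Equiv.Perm (Fin n) // pmp1243 σ = m} := by
  classical
  rw [Nat.card_eq_fintype_card, Nat.card_eq_fintype_card, Fintype.card_subtype,
    Fintype.card_subtype, Finset.card_filter, Finset.card_filter]
  simp only [pmp1234_eq, pmp1243_eq]
  exact main_sum n n le_rfl (fun a _ => if a = m then 1 else 0)
end

section
/- Let n ≥ 4 and let p_1,...,p_{n-2} be any rearrangement of 3,4,...,n. Then the positional marked patterns P_1 = 1\underline{2}p_1...p_{n-2}, P_2 = \underline{2}1p_1...p_{n-2}, and P_3 = 2\underline{1}p_1...p_{n-2} are pairwise pmp-Wilf equivalent: the statistics pmp_{P_1}, pmp_{P_2}, pmp_{P_3} are equidistributed over S_m for every m. -/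
/-- `σ` has a `τ`-match (with marked position `ℓ`) at position `i`. -/
def HasPMPMatch {k n : ℕ} (τ : Equiv.Perm (Fin k)) (ℓ : Fin k)
    (σ : Equiv.Perm (Fin n)) (i : Fin n) : Prop :=
  ∃ f : Fin k → Fin n, StrictMono f ∧ f ℓ = i ∧
    ∀ a b : Fin k, σ (f a) < σ (f b) ↔ τ a < τ b

/-- The number of positions at which `σ` has a `τ`-match. -/
noncomputable def pmpCount {k n : ℕ} (τ : Equiv.Perm (Fin k)) (ℓ : Fin k)
    (σ : Equiv.Perm (Fin n)) : ℕ :=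
  Nat.card {i : Fin n // HasPMPMatch τ ℓ σ i}

open Finset Polynomial

namespace PMP

/-- `x` and `y` agree strictly to the right of `r`-many columns. -/
def Agree {m : ℕ} (r : ℕ) (s t : Equiv.Perm (Fin m)) : Prop :=
  ∀ i : Fin m, r ≤ (i : ℕ) → s i = t i

open Classical in
theorem tree {m : ℕ} (D : Finset (Equiv.Perm (Fin m))) (c : ℕ → ℕ)
    (bad : ℕ → Equiv.Perm (Fin m) → Prop)
    (hbad : ∀ k : Fin m, ∀ s ∈ D, ∃ T : Finset (Fin m), T.card = c k ∧
      (∀ v, v ∈ T ↔ ∃ t ∈ D, Agree (k + 1) s t ∧ t k = v) ∧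
      ∃ e ∈ T, ∀ t ∈ D, Agree (k + 1) s t → (bad k t ↔ t k ≠ e)) :
    ∀ r : ℕ, r ≤ m → ∀ s ∈ D,
      ∑ t ∈ D with Agree r s t, (X : ℕ[X]) ^ (#{k ∈ range r | bad k t}) =
        ∏ k ∈ range r, (1 + ((c k - 1 : ℕ) : ℕ[X]) * X) := by
  intro r
  induction r with
  | zero =>
    intro _ s hs
    have : {t ∈ D | Agree 0 s t} = {s} := by
      ext t
      simp only [mem_filter, mem_singleton]
      constructor
      · rintro ⟨_, h⟩
        exact Equiv.ext fun i => (h i (Nat.zero_le _)).symm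
      · rintro rfl
        exact ⟨hs, fun _ _ => rfl⟩
    rw [this]
    simp
  | succ r ih =>
    intro hr s hs
    obtain ⟨T, hTc, hT, e, he, hb⟩ := hbad ⟨r, hr⟩ s hs
    simp only at hTc hT hb
    rw [← sum_fiberwise_of_maps_to (s := {t ∈ D | Agree (r + 1) s t}) (t := T)
      (g := fun t => t ⟨r, hr⟩)
      (fun t ht => (hT _).2 ⟨t, (mem_filter.1 ht).1, (mem_filter.1 ht).2, rfl⟩)]
    have key : ∀ v ∈ T, ∑ t ∈ {t ∈ D | Agree (r + 1) s t} with t ⟨r, hr⟩ = v,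
        (X : ℕ[X]) ^ (#{k ∈ range (r + 1) | bad k t}) =
        (if v = e then 1 else X) * ∏ k ∈ range r, (1 + ((c k - 1 : ℕ) : ℕ[X]) * X) := by
      intro v hv
      obtain ⟨u, huD, hsu, huv⟩ := (hT v).1 hv
      rw [← ih (by omega) u huD, mul_sum]
      have hset : {t ∈ {t ∈ D | Agree (r + 1) s t} | t ⟨r, hr⟩ = v} =
          {t ∈ D | Agree r u t} := by
        ext t
        simp only [mem_filter]
        constructor
        · rintro ⟨⟨h1, h2⟩, h3⟩
          refine ⟨h1, fun i hi => ?_⟩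
          rcases Nat.lt_or_ge r i with h | h
          · rw [← hsu i h, h2 i h]
          · have : i = ⟨r, hr⟩ := Fin.ext (by simp; omega)
            rw [this, huv, h3]
        · rintro ⟨h1, h2⟩
          refine ⟨⟨h1, fun i hi => ?_⟩, ?_⟩
          · rw [hsu i hi, h2 i (by omega)]
          · rw [← huv, h2 ⟨r, hr⟩ le_rfl]
      rw [hset]
      refine sum_congr rfl fun t ht => ?_
      have ht' := ht
      rw [← hset] at ht'
      simp only [mem_filter] at ht'
      have hbt := hb t ht'.1.1 ht'.1.2
      rw [ht'.2] at hbt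
      rw [range_add_one, filter_insert]
      by_cases hve : v = e
      · rw [if_neg (by tauto), if_pos hve, one_mul]
      · rw [if_pos (by tauto), if_neg hve, card_insert_of_notMem (by simp), pow_succ, mul_comm]
    rw [sum_congr rfl key, ← sum_mul, prod_range_succ, mul_comm]
    congr 1
    rw [← add_sum_erase _ _ he, if_pos rfl,
      sum_congr rfl (g := fun _ => (X : ℕ[X])) (fun v hv => if_neg (ne_of_mem_erase hv)),
      sum_const, card_erase_of_mem he, hTc, nsmul_eq_mul]

/-- There is an occurrence of the pattern `q` strictly north-east of `(x, y)`. -/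
def R {k m n : ℕ} (q : Fin k → Fin n) (s : Equiv.Perm (Fin m)) (x y : Fin m) : Prop :=
  ∃ g : Fin k → Fin m, StrictMono g ∧ (∀ a, x < g a ∧ y < s (g a)) ∧
    ∀ a b, s (g a) < s (g b) ↔ q a < q b

section
variable {k m n : ℕ} {q : Fin k → Fin n}

theorem R_mono {s : Equiv.Perm (Fin m)} {x y x' y' : Fin m} (h : R q s x y)
    (hx : x' ≤ x) (hy : y' ≤ y) : R q s x' y' := by
  obtain ⟨g, h1, h2, h3⟩ := h
  exact ⟨g, h1, fun a => ⟨hx.trans_lt (h2 a).1, hy.trans_lt (h2 a).2⟩, h3⟩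

theorem R_extremal (s : Equiv.Perm (Fin m)) : ∀ d : ℕ, ∀ x y : Fin m, m - (x : ℕ) ≤ d →
    R q s x y →
    ∃ g : Fin k → Fin m, StrictMono g ∧ (∀ a, x < g a ∧ y < s (g a)) ∧
      (∀ a b, s (g a) < s (g b) ↔ q a < q b) ∧ ∀ a, ¬ R q s (g a) (s (g a)) := by
  intro d
  induction d with
  | zero => intro x y hx; have := x.2; omega
  | succ d ih =>
    intro x y hx h
    obtain ⟨g, h1, h2, h3⟩ := h
    by_cases hc : ∃ a, R q s (g a) (s (g a))
    · obtain ⟨a, ha⟩ := hc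
      have hxa := h2 a
      obtain ⟨g', h1', h2', h3', h4'⟩ := ih _ _ (by have := hxa.1; rw [Fin.lt_def] at this; omega) ha
      exact ⟨g', h1', fun b => ⟨hxa.1.trans (h2' b).1, hxa.2.trans (h2' b).2⟩, h3', h4'⟩
    · push Not at hc
      exact ⟨g, h1, h2, h3, hc⟩

theorem R_eq {s t : Equiv.Perm (Fin m)}
    (h1 : ∀ i, ¬ R q s i (s i) → t i = s i) (h2 : ∀ i, R q s i (s i) → R q s i (t i)) :
    R q t = R q s := by
  funext x y
  apply propext
  constructor
  · rintro ⟨g, g1, g2, g3⟩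
    by_cases hc : ∃ a, R q s (g a) (s (g a))
    · obtain ⟨a, ha⟩ := hc
      exact R_mono (h2 _ ha) (g2 a).1.le (g2 a).2.le
    · push Not at hc
      have e : ∀ a, t (g a) = s (g a) := fun a => h1 _ (hc a)
      simp only [e] at g2 g3
      exact ⟨g, g1, g2, g3⟩
  · intro h
    obtain ⟨g, g1, g2, g3, g4⟩ := R_extremal s _ x y le_rfl h
    have e : ∀ a, t (g a) = s (g a) := fun a => h1 _ (g4 a)
    refine ⟨g, g1, ?_, ?_⟩
    · simpa only [e] using g2
    · simpa only [e] using g3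

open Classical in
/-- The data kept fixed: the region and the placement outside it. -/
noncomputable def key (q : Fin k → Fin n) (s : Equiv.Perm (Fin m)) :
    (Fin m → Fin m → Prop) × (Fin m → Option (Fin m)) :=
  (R q s, fun i => if R q s i (s i) then none else some (s i))

theorem key_eq_iff {s t : Equiv.Perm (Fin m)} : key q t = key q s ↔
    R q t = R q s ∧ (∀ i, R q s i (s i) ↔ R q s i (t i)) ∧
      ∀ i, ¬ R q s i (s i) → t i = s i := by
  unfold key
  constructor
  · intro h
    have hR : R q t = R q s := congrArg Prod.fst h
    have h2 := fun i => congrFun (congrArg Prod.snd h) i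
    simp only [hR] at h2
    refine ⟨hR, fun i => ?_, fun i hi => ?_⟩
    · have := h2 i
      by_cases a : R q s i (s i) <;> by_cases b : R q s i (t i) <;> simp_all
    · have := h2 i
      by_cases b : R q s i (t i) <;> simp_all
  · rintro ⟨hR, h1, h2⟩
    refine Prod.ext hR ?_
    funext i
    simp only [hR]
    by_cases a : R q s i (s i)
    · rw [if_pos a, if_pos (by rw [hR]; exact (h1 i).1 a)]
    · rw [if_neg a, if_neg (by rw [hR]; exact fun b => a ((h1 i).2 b)), h2 i a]

theorem key_swap {s : Equiv.Perm (Fin m)} {j i : Fin m} (hji : j ≤ i) (hi : R q s i (s i))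
    (h : R q s i (s j)) : key q (s * Equiv.swap j i) = key q s := by
  have hj : R q s j (s j) := R_mono h hji le_rfl
  have h1 : ∀ l, ¬ R q s l (s l) → (s * Equiv.swap j i) l = s l := by
    intro l hl
    have a : l ≠ j := by rintro rfl; exact hl hj
    have b : l ≠ i := by rintro rfl; exact hl hi
    simp [Equiv.swap_apply_of_ne_of_ne a b]
  have h2 : ∀ l, R q s l (s l) → R q s l ((s * Equiv.swap j i) l) := by
    intro l hl
    rw [Equiv.Perm.mul_apply]
    by_cases a : l = j
    · subst a; rw [Equiv.swap_apply_left]; exact R_mono hi hji le_rfl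
    · by_cases b : l = i
      · subst b; rw [Equiv.swap_apply_right]; exact h
      · rw [Equiv.swap_apply_of_ne_of_ne a b]; exact hl
  refine key_eq_iff.2 ⟨R_eq h1 h2, fun l => ⟨h2 l, fun hl => ?_⟩, h1⟩
  by_contra hc
  rw [h1 l hc] at hl
  exact hc hl

open Classical in
/-- The available values in column `i`. -/
noncomputable def avail (q : Fin k → Fin n) (s : Equiv.Perm (Fin m)) (i : Fin m) :
    Finset (Fin m) :=
  if R q s i (s i) then ({j | j ≤ i ∧ R q s i (s j)} : Finset (Fin m)).image s else {s i}

theorem avail_spec (s : Equiv.Perm (Fin m)) (i v : Fin m) :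
    v ∈ avail q s i ↔ ∃ t, key q t = key q s ∧ Agree (i + 1) s t ∧ t i = v := by
  unfold avail
  by_cases hi : R q s i (s i)
  · rw [if_pos hi]
    simp only [mem_image, mem_filter, mem_univ, true_and]
    constructor
    · rintro ⟨j, ⟨hj, hR⟩, rfl⟩
      refine ⟨s * Equiv.swap j i, key_swap hj hi hR, fun l hl => ?_, by simp⟩
      have a : l ≠ j := by rintro rfl; rw [Fin.le_def] at hj; omega
      have b : l ≠ i := by rintro rfl; omega
      simp [Equiv.swap_apply_of_ne_of_ne a b]
    · rintro ⟨t, ht, hag, rfl⟩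
      obtain ⟨h1, h2, h3⟩ := key_eq_iff.1 ht
      refine ⟨s.symm (t i), ⟨?_, ?_⟩, by simp⟩
      · by_contra hc
        push Not at hc
        have := hag (s.symm (t i)) (by rw [Fin.lt_def] at hc; omega)
        rw [Equiv.apply_symm_apply] at this
        have := t.injective this
        rw [← this] at hc
        exact lt_irrefl _ hc
      · rw [Equiv.apply_symm_apply]
        exact (h2 i).1 hi
  · rw [if_neg hi]
    simp only [mem_singleton]
    constructor
    · rintro rfl
      exact ⟨s, rfl, fun _ _ => rfl, rfl⟩
    · rintro ⟨t, ht, -, rfl⟩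
      exact (key_eq_iff.1 ht).2.2 i hi

theorem avail_card {s t : Equiv.Perm (Fin m)} (h : key q t = key q s) (i : Fin m) :
    (avail q t i).card = (avail q s i).card := by
  classical
  obtain ⟨h1, h2, h3⟩ := key_eq_iff.1 h
  unfold avail
  rw [h1]
  by_cases hi : R q s i (s i)
  · rw [if_pos hi, if_pos ((h2 i).1 hi), card_image_of_injective _ t.injective,
      card_image_of_injective _ s.injective]
    -- values of columns in the region
    have split : ∀ u : Equiv.Perm (Fin m), (∀ i, R q s i (s i) ↔ R q s i (u i)) →
        #{j | j ≤ i ∧ R q s i (u j)} + #{j | i < j ∧ R q s j (s j)} =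
        #{j | R q s j (s j) ∧ R q s i (u j)} := by
      intro u hu
      rw [← card_union_of_disjoint]
      · congr 1
        ext j
        simp only [mem_union, mem_filter, mem_univ, true_and]
        constructor
        · rintro (⟨a, b⟩ | ⟨a, b⟩)
          · exact ⟨(hu j).2 (R_mono b a le_rfl), b⟩
          · exact ⟨b, R_mono ((hu j).1 b) a.le le_rfl⟩
        · rintro ⟨a, b⟩
          rcases le_or_gt j i with c | c
          · exact Or.inl ⟨c, b⟩
          · exact Or.inr ⟨c, a⟩
      · rw [disjoint_left]
        intro j a b
        simp only [mem_filter, mem_univ, true_and] at a b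
        exact absurd a.1 (not_le.2 b.1)
    have e1 := split t h2
    have e2 := split s (fun _ => Iff.rfl)
    have compl : ∀ u : Equiv.Perm (Fin m), 
        #{j | R q s j (s j) ∧ R q s i (u j)} + #{j | ¬ R q s j (s j) ∧ R q s i (u j)} =
        #{v | R q s i v} := by
      intro u
      rw [← card_union_of_disjoint]
      · rw [← card_image_of_injective _ u.injective]
        congr 1
        ext v
        simp only [mem_image, mem_union, mem_filter, mem_univ, true_and]
        constructor
        · rintro ⟨j, (a | a), rfl⟩
          · exact a.2
          · exact a.2
        · intro hv
          refine ⟨u.symm v, ?_, by simp⟩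
          rw [Equiv.apply_symm_apply]
          tauto
      · rw [disjoint_left]
        intro j a b
        simp only [mem_filter, mem_univ, true_and] at a b
        exact b.1 a.1
    have f1 := compl t
    have f2 := compl s
    have f3 : #{j | ¬ R q s j (s j) ∧ R q s i (t j)} = #{j | ¬ R q s j (s j) ∧ R q s i (s j)} := by
      congr 1
      ext j
      simp only [mem_filter, mem_univ, true_and]
      constructor
      · rintro ⟨a, b⟩; rw [h3 j a] at b; exact ⟨a, b⟩
      · rintro ⟨a, b⟩; rw [← h3 j a] at b; exact ⟨a, b⟩
    omega
  · rw [if_neg hi, if_neg (fun b => hi ((h2 i).2 b)), card_singleton, card_singleton]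

theorem avail_nonempty (s : Equiv.Perm (Fin m)) (i : Fin m) : (avail q s i).Nonempty :=
  ⟨s i, (avail_spec s i _).2 ⟨s, rfl, fun _ _ => rfl, rfl⟩⟩

theorem avail_congr {s t : Equiv.Perm (Fin m)} {i : Fin m} (h : key q t = key q s)
    (ha : Agree (i + 1) s t) : avail q t i = avail q s i := by
  ext v
  rw [avail_spec, avail_spec]
  constructor
  · rintro ⟨u, h1, h2, h3⟩
    exact ⟨u, h1.trans h, fun l hl => (ha l hl).trans (h2 l hl), h3⟩
  · rintro ⟨u, h1, h2, h3⟩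
    exact ⟨u, h1.trans h.symm, fun l hl => (ha l hl).symm.trans (h2 l hl), h3⟩

/-- First statistic. -/
def B1 (q : Fin k → Fin n) (s : Equiv.Perm (Fin m)) (i : Fin m) : Prop :=
  R q s i (s i) ∧ ∃ j < i, s j < s i

/-- Second statistic. -/
def B3 (q : Fin k → Fin n) (s : Equiv.Perm (Fin m)) (i : Fin m) : Prop :=
  ∃ j < i, s i < s j ∧ R q s i (s j)

theorem B1_iff (s : Equiv.Perm (Fin m)) (i : Fin m) :
    B1 q s i ↔ s i ≠ (avail q s i).min' (avail_nonempty s i) := by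
  have hmem : s i ∈ avail q s i := (avail_spec s i _).2 ⟨s, rfl, fun _ _ => rfl, rfl⟩
  have hmin := (avail q s i).min'_mem (avail_nonempty s i)
  constructor
  · rintro ⟨hi, j, hj, hlt⟩ he
    have : s j ∈ avail q s i := by
      unfold avail
      rw [if_pos hi]
      exact mem_image_of_mem _ (by simpa using ⟨hj.le, R_mono hi le_rfl hlt.le⟩)
    have := (avail q s i).min'_le _ this
    rw [← he] at this
    exact absurd hlt (not_lt.2 this)
  · intro hne
    have hlt := lt_of_le_of_ne ((avail q s i).min'_le _ hmem) hne.symm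
    generalize (avail q s i).min' (avail_nonempty s i) = e at *
    unfold avail at hmin
    by_cases hi : R q s i (s i)
    · rw [if_pos hi] at hmin
      simp only [mem_image, mem_filter, mem_univ, true_and] at hmin
      obtain ⟨j, ⟨hj, _⟩, rfl⟩ := hmin
      refine ⟨hi, j, lt_of_le_of_ne hj ?_, hlt⟩
      rintro rfl
      exact hne rfl
    · rw [if_neg hi] at hmin
      exact absurd (mem_singleton.1 hmin).symm hne

theorem B3_iff (s : Equiv.Perm (Fin m)) (i : Fin m) :
    B3 q s i ↔ s i ≠ (avail q s i).max' (avail_nonempty s i) := by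
  have hmem : s i ∈ avail q s i := (avail_spec s i _).2 ⟨s, rfl, fun _ _ => rfl, rfl⟩
  have hmax := (avail q s i).max'_mem (avail_nonempty s i)
  constructor
  · rintro ⟨j, hj, hlt, hR⟩ he
    have : s j ∈ avail q s i := by
      unfold avail
      rw [if_pos (R_mono hR le_rfl hlt.le)]
      exact mem_image_of_mem _ (by simpa using ⟨hj.le, hR⟩)
    have := (avail q s i).le_max' _ this
    rw [← he] at this
    exact absurd hlt (not_lt.2 this)
  · intro hne
    have hlt := lt_of_le_of_ne ((avail q s i).le_max' _ hmem) hne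
    generalize (avail q s i).max' (avail_nonempty s i) = e at *
    unfold avail at hmax
    by_cases hi : R q s i (s i)
    · rw [if_pos hi] at hmax
      simp only [mem_image, mem_filter, mem_univ, true_and] at hmax
      obtain ⟨j, ⟨hj, hR⟩, rfl⟩ := hmax
      refine ⟨j, lt_of_le_of_ne hj ?_, hlt, hR⟩
      rintro rfl
      exact hne rfl
    · rw [if_neg hi] at hmax
      exact absurd (mem_singleton.1 hmax).symm hne

open Classical in
theorem fiber_sum (s : Equiv.Perm (Fin m)) (B : Equiv.Perm (Fin m) → Fin m → Prop)
    (e : ∀ T : Finset (Fin m), T.Nonempty → Fin m) (he : ∀ T h, e T h ∈ T)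
    (hB : ∀ t i, B t i ↔ t i ≠ e (avail q t i) (avail_nonempty t i)) :
    ∑ t with key q t = key q s, (X : ℕ[X]) ^ (#{i | B t i}) =
      ∏ i ∈ range m, (1 + (((if h : i < m then (avail q s ⟨i, h⟩).card else 0) - 1 : ℕ) : ℕ[X]) * X) := by
  rw [← tree ({t | key q t = key q s} : Finset _)
    (fun i => if h : i < m then (avail q s ⟨i, h⟩).card else 0)
    (fun i t => ∃ h : i < m, B t ⟨i, h⟩) ?_ m le_rfl s (by simp)]
  · have : ({t ∈ ({t | key q t = key q s} : Finset (Equiv.Perm (Fin m))) | Agree m s t}) =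
        ({t | key q t = key q s} : Finset (Equiv.Perm (Fin m))) :=
      filter_true_of_mem fun t _ i hi => absurd i.2 (by omega)
    rw [this]
    refine sum_congr rfl fun t _ => ?_
    congr 1
    rw [← card_map Fin.valEmbedding]
    congr 1
    ext i
    simp only [mem_map, mem_filter, mem_univ, true_and, mem_range, Fin.valEmbedding_apply]
    constructor
    · rintro ⟨a, h, rfl⟩
      exact ⟨a.2, a.2, h⟩
    · rintro ⟨_, h, hb⟩
      exact ⟨⟨i, h⟩, hb, rfl⟩
  · intro i t ht
    simp only [mem_filter, mem_univ, true_and] at ht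
    refine ⟨avail q t i, ?_, ?_, e (avail q t i) (avail_nonempty t i), he _ _, ?_⟩
    · simp [avail_card ht]
    · intro v
      rw [avail_spec]
      simp [ht]
    · intro u hu hag
      simp only [mem_filter, mem_univ, true_and] at hu
      have hc := avail_congr (hu.trans ht.symm) hag
      have := hB u i
      simp only [hc] at this
      simpa using this

open Classical in
theorem sum_eq (m : ℕ) (q : Fin k → Fin n) :
    ∑ t : Equiv.Perm (Fin m), (X : ℕ[X]) ^ (#{i | B1 q t i}) =
      ∑ t : Equiv.Perm (Fin m), (X : ℕ[X]) ^ (#{i | B3 q t i}) := by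
  rw [← sum_fiberwise_of_maps_to (t := univ.image (key (m := m) q)) (g := key q)
      (fun t ht => mem_image_of_mem _ ht),
    ← sum_fiberwise_of_maps_to (t := univ.image (key (m := m) q)) (g := key q)
      (fun t ht => mem_image_of_mem _ ht)]
  refine sum_congr rfl fun κ hκ => ?_
  obtain ⟨s, -, rfl⟩ := mem_image.1 hκ
  rw [fiber_sum s (B1 q) (fun T h => T.min' h) (fun T h => T.min'_mem h) B1_iff,
    fiber_sum s (B3 q) (fun T h => T.max' h) (fun T h => T.max'_mem h) B3_iff]

end

theorem card_of_sum {α : Type*} [Fintype α] [DecidableEq α] {f g : α → ℕ}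
    (h : ∑ a, (X : ℕ[X]) ^ f a = ∑ a, (X : ℕ[X]) ^ g a) (M : ℕ) :
    Nat.card {a // f a = M} = Nat.card {a // g a = M} := by
  have := congrArg (fun p => p.coeff M) h
  simp only [finsetSum_coeff, coeff_X_pow, sum_boole, Nat.cast_id] at this
  rw [Nat.card_eq_fintype_card, Nat.card_eq_fintype_card, Fintype.card_subtype,
    Fintype.card_subtype]
  simpa only [eq_comm] using this

theorem forall_two {k : ℕ} {P : Fin (k + 2) → Prop} (h0 : P 0) (h1 : P 1)
    (h2 : ∀ a : Fin k, P a.succ.succ) (a : Fin (k + 2)) : P a :=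
  Fin.cases h0 (fun a => Fin.cases h1 h2 a) a

/-- Build an occurrence out of two points and an occurrence of the tail. -/
theorem build {k m : ℕ} (τ : Equiv.Perm (Fin (k + 2))) (s : Equiv.Perm (Fin m)) {i j : Fin m}
    {g : Fin k → Fin m} (hji : j < i) (hg : StrictMono g) (hig : ∀ a, i < g a)
    (hp : ∀ a b, s (g a) < s (g b) ↔ τ a.succ.succ < τ b.succ.succ)
    (h01 : s j < s i ↔ τ 0 < τ 1) (h10 : s i < s j ↔ τ 1 < τ 0)
    (hj : ∀ a, s j < s (g a)) (hi : ∀ a, s i < s (g a))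
    (h0 : ∀ a : Fin k, τ 0 < τ a.succ.succ) (h1 : ∀ a : Fin k, τ 1 < τ a.succ.succ) :
    HasPMPMatch τ 1 s i := by
  obtain ⟨f, f0, f1, f2⟩ : ∃ f : Fin (k + 2) → Fin m, f 0 = j ∧ f 1 = i ∧
      ∀ a : Fin k, f a.succ.succ = g a :=
    ⟨Fin.cons j (Fin.cons i g), rfl, rfl, fun _ => rfl⟩
  refine ⟨f, ?_, f1, ?_⟩
  · intro a b
    revert a b
    refine forall_two (forall_two ?_ ?_ ?_) (forall_two ?_ ?_ ?_)
      fun a => (forall_two ?_ ?_ fun b => ?_)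
    · intro h; exact absurd h (lt_irrefl _)
    · intro _; rwa [f0, f1]
    · intro b _; rw [f0, f2]; exact hji.trans (hig b)
    · intro h; simp at h
    · intro h; exact absurd h (lt_irrefl _)
    · intro b _; rw [f1, f2]; exact hig b
    · intro h; simp at h
    · intro h; simp [Fin.lt_def] at h
    · intro h; rw [f2, f2]; exact hg (by simpa using h)
  · refine forall_two (forall_two ?_ ?_ ?_) (forall_two ?_ ?_ ?_)
      fun a => (forall_two ?_ ?_ fun b => ?_)
    · simp
    · rwa [f0, f1]
    · intro b; rw [f0, f2]; exact iff_of_true (hj b) (h0 b)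
    · rwa [f0, f1]
    · simp
    · intro b; rw [f1, f2]; exact iff_of_true (hi b) (h1 b)
    · rw [f0, f2]; exact iff_of_false (hj a).not_gt (h0 a).not_gt
    · rw [f1, f2]; exact iff_of_false (hi a).not_gt (h1 a).not_gt
    · rw [f2, f2]; exact hp a b

theorem tail_gt {k : ℕ} {τ : Equiv.Perm (Fin (k + 2))} {x y : Fin (k + 2)}
    (hx : x = 0 ∧ y = 1 ∨ x = 1 ∧ y = 0) (h0 : τ x = 0) (h1 : τ y = 1)
    (a : Fin k) : 1 < τ a.succ.succ := by
  have hne : ∀ z, z = x ∨ z = y → τ a.succ.succ ≠ τ z := by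
    intro z hz h
    have := τ.injective h
    rcases hx with ⟨rfl, rfl⟩ | ⟨rfl, rfl⟩ <;> rcases hz with rfl | rfl <;>
      simp [Fin.ext_iff] at this
  have a0 := hne x (Or.inl rfl)
  have a1 := hne y (Or.inr rfl)
  rw [h0] at a0
  rw [h1] at a1
  rw [ne_eq, Fin.ext_iff] at a0 a1
  rw [Fin.lt_def]
  rw [Fin.val_zero] at a0
  rw [Fin.val_one] at a1 ⊢
  omega

theorem match1 {k m : ℕ} (τ : Equiv.Perm (Fin (k + 2))) (h0 : τ 0 = 0) (h1 : τ 1 = 1)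
    (s : Equiv.Perm (Fin m)) (i : Fin m) :
    HasPMPMatch τ 1 s i ↔ B1 (fun a : Fin k => τ a.succ.succ) s i := by
  have hne := tail_gt (τ := τ) (Or.inl ⟨rfl, rfl⟩) h0 h1
  have h01 : (0 : Fin (k + 2)) < 1 := by simp
  constructor
  · rintro ⟨f, hf, rfl, hp⟩
    refine ⟨⟨fun a => f a.succ.succ, fun a b hab => hf (by simpa using hab), fun a => ⟨hf ?_, ?_⟩,
      fun a b => hp _ _⟩, f 0, hf h01, ?_⟩
    · simp [Fin.lt_def]
    · rw [hp, h1]; exact hne a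
    · rw [hp, h0, h1]; exact h01
  · rintro ⟨⟨g, g1, g2, g3⟩, j, hj, hlt⟩
    refine build τ s hj g1 (fun a => (g2 a).1) g3 ?_ ?_ (fun a => hlt.trans (g2 a).2)
      (fun a => (g2 a).2) ?_ ?_
    · rw [h0, h1]; exact iff_of_true hlt h01
    · rw [h0, h1]; exact iff_of_false hlt.not_gt h01.not_gt
    · intro a; rw [h0]; exact h01.trans (hne a)
    · intro a; rw [h1]; exact hne a

theorem match3 {k m : ℕ} (τ : Equiv.Perm (Fin (k + 2))) (h0 : τ 0 = 1) (h1 : τ 1 = 0)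
    (s : Equiv.Perm (Fin m)) (i : Fin m) :
    HasPMPMatch τ 1 s i ↔ B3 (fun a : Fin k => τ a.succ.succ) s i := by
  have hne := tail_gt (τ := τ) (Or.inr ⟨rfl, rfl⟩) h1 h0
  have h01 : (0 : Fin (k + 2)) < 1 := by simp
  constructor
  · rintro ⟨f, hf, rfl, hp⟩
    refine ⟨f 0, hf h01, ?_, fun a => f a.succ.succ, fun a b hab => hf (by simpa using hab),
      fun a => ⟨hf ?_, ?_⟩, fun a b => hp _ _⟩
    · rw [hp, h0, h1]; exact h01
    · simp [Fin.lt_def]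
    · rw [hp, h0]; exact hne a
  · rintro ⟨j, hj, hlt, ⟨g, g1, g2, g3⟩⟩
    refine build τ s hj g1 (fun a => (g2 a).1) g3 ?_ ?_ (fun a => (g2 a).2)
      (fun a => hlt.trans (g2 a).2) ?_ ?_
    · rw [h0, h1]; exact iff_of_false hlt.not_gt h01.not_gt
    · rw [h0, h1]; exact iff_of_true hlt h01
    · intro a; rw [h0]; exact hne a
    · intro a; rw [h1]; exact h01.trans (hne a)

theorem match_inv {k m : ℕ} {τ : Equiv.Perm (Fin k)} {l : Fin k} {s : Equiv.Perm (Fin m)}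
    {i : Fin m} (h : HasPMPMatch τ l s i) : HasPMPMatch τ⁻¹ (τ l) s⁻¹ (s i) := by
  obtain ⟨f, hf, rfl, hp⟩ := h
  refine ⟨fun a => s (f (τ⁻¹ a)), ?_, ?_, ?_⟩
  · intro a b hab
    simp only
    rw [hp]
    simpa using hab
  · simp
  · intro a b
    have e : ∀ x, s⁻¹ (s x) = x := fun x => s.symm_apply_apply x
    simp only [e]
    exact hf.lt_iff_lt

theorem count_inv {k m : ℕ} (τ : Equiv.Perm (Fin k)) (l : Fin k) (s : Equiv.Perm (Fin m)) :
    pmpCount τ l s = pmpCount τ⁻¹ (τ l) s⁻¹ := by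
  unfold pmpCount
  refine Nat.card_congr (s.subtypeEquiv fun i => ⟨match_inv, fun h => ?_⟩)
  have := match_inv h
  simpa using this

theorem card_inv {k m : ℕ} (τ : Equiv.Perm (Fin k)) (l : Fin k) (M : ℕ) :
    Nat.card {s : Equiv.Perm (Fin m) // pmpCount τ l s = M} =
      Nat.card {s : Equiv.Perm (Fin m) // pmpCount τ⁻¹ (τ l) s = M} := by
  refine Nat.card_congr ((Equiv.inv _).subtypeEquiv fun s => ?_)
  rw [count_inv]
  rfl

theorem main13 {k : ℕ} (τ ρ : Equiv.Perm (Fin (k + 2))) (h0 : τ 0 = 0) (h1 : τ 1 = 1)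
    (r0 : ρ 0 = 1) (r1 : ρ 1 = 0) (hr : ∀ a : Fin k, ρ a.succ.succ = τ a.succ.succ) (m M : ℕ) :
    Nat.card {s : Equiv.Perm (Fin m) // pmpCount τ 1 s = M} =
      Nat.card {s : Equiv.Perm (Fin m) // pmpCount ρ 1 s = M} := by
  classical
  have e := sum_eq m (fun a : Fin k => τ a.succ.succ)
  have c1 : ∀ s : Equiv.Perm (Fin m), pmpCount τ 1 s =
      #{i | B1 (fun a : Fin k => τ a.succ.succ) s i} := by
    intro s
    unfold pmpCount
    simp only [match1 τ h0 h1]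
    rw [Nat.card_eq_fintype_card, Fintype.card_subtype]
  have c3 : ∀ s : Equiv.Perm (Fin m), pmpCount ρ 1 s =
      #{i | B3 (fun a : Fin k => τ a.succ.succ) s i} := by
    intro s
    unfold pmpCount
    simp only [match3 ρ r0 r1, hr]
    rw [Nat.card_eq_fintype_card, Fintype.card_subtype]
  simp only [c1, c3]
  convert card_of_sum (M := M) e

end PMP

/-- `τ` is the underlying permutation of `P₁ = 1\underline{2}p₁…p_{n-2}` (marked position 1),
`ρ` is the underlying permutation of `P₂ = \underline{2}1p₁…p_{n-2}` (marked position 0)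
and of `P₃ = 2\underline{1}p₁…p_{n-2}` (marked position 1); the three positional marked
patterns are pairwise `pmp`-Wilf equivalent. -/
theorem stmt15 (n : ℕ) (hn : 4 ≤ n) (τ ρ : Equiv.Perm (Fin n))
    (hτ0 : (τ ⟨0, by omega⟩ : ℕ) = 0) (hτ1 : (τ ⟨1, by omega⟩ : ℕ) = 1)
    (hρ0 : (ρ ⟨0, by omega⟩ : ℕ) = 1) (hρ1 : (ρ ⟨1, by omega⟩ : ℕ) = 0)
    (hrest : ∀ i : Fin n, 2 ≤ (i : ℕ) → ρ i = τ i)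
    (m M : ℕ) :
    Nat.card {σ : Equiv.Perm (Fin m) // pmpCount τ ⟨1, by omega⟩ σ = M} =
      Nat.card {σ : Equiv.Perm (Fin m) // pmpCount ρ ⟨0, by omega⟩ σ = M} ∧
    Nat.card {σ : Equiv.Perm (Fin m) // pmpCount ρ ⟨0, by omega⟩ σ = M} =
      Nat.card {σ : Equiv.Perm (Fin m) // pmpCount ρ ⟨1, by omega⟩ σ = M} := by
  obtain ⟨k, rfl⟩ : ∃ k, n = k + 2 := ⟨n - 2, by omega⟩
  have t0 : τ 0 = 0 := Fin.ext hτ0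
  have t1 : τ 1 = 1 := Fin.ext (by rw [Fin.val_one]; exact hτ1)
  have r0 : ρ 0 = 1 := Fin.ext (by rw [Fin.val_one]; exact hρ0)
  have r1 : ρ 1 = 0 := Fin.ext hρ1
  have A := PMP.main13 τ ρ t0 t1 r0 r1
    (fun a => hrest _ (by simp)) m M
  have B := PMP.main13 τ⁻¹ ρ⁻¹ (by rw [Equiv.Perm.inv_eq_iff_eq, t0])
    (by rw [Equiv.Perm.inv_eq_iff_eq, t1]) (by rw [Equiv.Perm.inv_eq_iff_eq, r1])
    (by rw [Equiv.Perm.inv_eq_iff_eq, r0])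
    (by
      intro a
      rw [Equiv.Perm.inv_eq_iff_eq]
      have key : ∀ b, τ b = a.succ.succ → a.succ.succ = ρ b := by
        refine PMP.forall_two ?_ ?_ ?_
        · intro h; rw [t0] at h; simp [Fin.ext_iff] at h
        · intro h; rw [t1] at h; simp [Fin.ext_iff] at h
        · intro b h; rw [hrest _ (by simp), h]
      exact key _ (by simp)) m M
  have C := PMP.card_inv (m := m) τ 1 M
  have D := PMP.card_inv (m := m) ρ 0 M
  rw [t1] at C
  rw [r0] at D
  have E := (C.trans B).trans D.symm
  exact ⟨E, E.symm.trans A⟩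
end
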